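/- Define ν(λ) = (1/2π)·arccos(λ/2) and, for 0 < λ < 1, t*(λ) = min{k ∈ ℕ, k ≥ 1 : dist(k·ν(λ), ℤ) < dist(4·ν(λ), ℤ)} (the first-order recurrence time). Then there exist constants C > 0 and λ₀ > 0 such that for all 0 < λ < λ₀ the defining set is nonempty (so t*(λ) is well defined) and |t*(λ) − π/λ| ≤ C; i.e. t*(λ) = π/λ + O(1) as λ → 0⁺. -/

import Mathlib

open scoped Classical

noncomputable section

open Set

/-- The scaled round-off map `F_λ` on the plane: `F_λ(z) = λ·F(z/λ)`,
so `F_λ(z) = (λ⌊z₁⌋ − z₂, z₁)`. -/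
def Fl (lam : ℝ) (z : ℝ × ℝ) : ℝ × ℝ := (lam * (⌊z.1⌋ : ℝ) - z.2, z.1)

/-- The inverse of `F_λ`. -/
def Flinv (lam : ℝ) (z : ℝ × ℝ) : ℝ × ℝ := (z.2, lam * (⌊z.2⌋ : ℝ) - z.1)

/-- Integer iterate `F_λ^k`, `k ∈ ℤ`. -/
def FlIter (lam : ℝ) (k : ℤ) (z : ℝ × ℝ) : ℝ × ℝ :=
  if 0 ≤ k then (Fl lam)^[k.toNat] z else (Flinv lam)^[(-k).toNat] z

/-- Membership in the scaled lattice `(λℤ)²`. -/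
def IsLatticePt (lam : ℝ) (z : ℝ × ℝ) : Prop := ∃ a b : ℤ, z = (lam * a, lam * b)

/-- The discrete vector field `𝐯(z) = F_λ⁴(z) − z`. -/
def vfield (lam : ℝ) (z : ℝ × ℝ) : ℝ × ℝ := (Fl lam)^[4] z - z

/-- The auxiliary (integrable) vector field `𝐰`. -/
def wfield (lam : ℝ) (z : ℝ × ℝ) : ℝ × ℝ :=
  (lam * (2 * (⌊z.2⌋ : ℝ) + 1), -(lam * (2 * (⌊z.1⌋ : ℝ) + 1)))

/-- The constant value `𝐰_{m,n}` of `𝐰` on the box `B_{m,n}`. -/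
def wmn (lam : ℝ) (m n : ℤ) : ℝ × ℝ :=
  (lam * (2 * (n : ℝ) + 1), -(lam * (2 * (m : ℝ) + 1)))

/-- The piecewise-affine function `P(x) = ⌊x⌋² + (2⌊x⌋+1)(x − ⌊x⌋)`. -/
def Pfun (x : ℝ) : ℝ := (⌊x⌋ : ℝ) ^ 2 + (2 * (⌊x⌋ : ℝ) + 1) * (x - (⌊x⌋ : ℝ))

/-- The Hamiltonian `𝒫(x,y) = P(x) + P(y)`. -/
def Ham (z : ℝ × ℝ) : ℝ := Pfun z.1 + Pfun z.2

/-- The round Hamiltonian `𝒬(x,y) = x² + y²`. -/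
def Qfun (z : ℝ × ℝ) : ℝ := z.1 ^ 2 + z.2 ^ 2

/-- The level set `Π(z)` of `𝒫` through `z`. -/
def levelSet (z : ℝ × ℝ) : Set (ℝ × ℝ) := {w | Ham w = Ham z}

/-- The grid `Δ` of horizontal and vertical integer lines. -/
def DeltaSet : Set (ℝ × ℝ) := {z | (∃ m : ℤ, z.1 = (m : ℝ)) ∨ (∃ n : ℤ, z.2 = (n : ℝ))}

/-- The box `B_{m,n}`. -/
def Bbox (m n : ℤ) : Set (ℝ × ℝ) := {z | ⌊z.1⌋ = m ∧ ⌊z.2⌋ = n}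

/-- The lattice `ℤ² ⊂ ℝ²`. -/
def intLattice : Set (ℝ × ℝ) := {z | ∃ a b : ℤ, z = ((a : ℝ), (b : ℝ))}

/-- `r(c)`: the number of representations of `c` as a sum of two integer squares. -/
def rfun (c : ℝ) : ℕ := Set.ncard {p : ℤ × ℤ | ((p.1 : ℝ)) ^ 2 + ((p.2 : ℝ)) ^ 2 = c}

/-- Euclidean distance from `z` to the symmetry line `y = x`. -/
def dG (z : ℝ × ℝ) : ℝ := |z.1 - z.2| / Real.sqrt 2

/-- The integer round-off `R`. -/
def Rfl (z : ℝ × ℝ) : ℤ × ℤ := (⌊z.1⌋, ⌊z.2⌋)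

/-- The rescaled round-off `R_λ(w) = λ·R(w/λ)`. -/
def Rlam (lam : ℝ) (w : ℝ × ℝ) : ℝ × ℝ :=
  (lam * (⌊w.1 / lam⌋ : ℝ), lam * (⌊w.2 / lam⌋ : ℝ))

/-- The return domain `X`. -/
def Xdom (lam : ℝ) : Set (ℝ × ℝ) :=
  {z | IsLatticePt lam z ∧ 0 ≤ z.1 ∧ 0 ≤ z.2 ∧
    dG z ≤ dG ((Fl lam)^[4] z) ∧ dG z < dG ((Flinv lam)^[4] z)}

/-- Forward transit time `τ` to `X`. -/
def tau (lam : ℝ) (z : ℝ × ℝ) : ℕ := sInf {k : ℕ | 1 ≤ k ∧ (Fl lam)^[k] z ∈ Xdom lam}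

/-- Backward transit time `τ₋` to `X`. -/
def tauMinus (lam : ℝ) (z : ℝ × ℝ) : ℕ := sInf {k : ℕ | (Flinv lam)^[k] z ∈ Xdom lam}

/-- The return orbit `O_τ(z)`. -/
def returnOrbit (lam : ℝ) (z : ℝ × ℝ) : Set (ℝ × ℝ) :=
  {w | ∃ k : ℤ, -(tauMinus lam z : ℤ) ≤ k ∧ k ≤ (tau lam z : ℤ) ∧ w = FlIter lam k z}

/-- The first-return map `Φ`. -/
def Phi (lam : ℝ) (z : ℝ × ℝ) : ℝ × ℝ := (Fl lam)^[tau lam z] z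

/-- The full orbit `O(z) = {F_λ^t(z) : t ∈ ℤ}`. -/
def fullOrbit (lam : ℝ) (z : ℝ × ℝ) : Set (ℝ × ℝ) := {w | ∃ t : ℤ, w = FlIter lam t z}

/-- The set `Λ` of transition points. -/
def TransSet (lam : ℝ) : Set (ℝ × ℝ) :=
  {z | IsLatticePt lam z ∧ Rfl ((Fl lam)^[4] z) ≠ Rfl z}

/-- The set `Σ = ⋃ Σ_{m,n}`. -/
def SigmaSet (lam : ℝ) : Set (ℝ × ℝ) :=
  {z | z ∈ TransSet lam ∧ ∃ m n : ℤ,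
    max |z.1 - (m : ℝ)| |z.2 - (n : ℝ)| ≤
      lam * (max |2 * (m : ℝ) + 1| |2 * (n : ℝ) + 1| + 2)}

/-- `ℰ`: the natural numbers which are sums of two integer squares. -/
def Eset : Set ℕ := {n | ∃ a b : ℤ, (n : ℤ) = a ^ 2 + b ^ 2}

/-- The successor of `e` in `ℰ`. -/
def nextE (e : ℕ) : ℕ := sInf {f | f ∈ Eset ∧ e < f}

/-- The critical interval `I^e = (e, e′)`. -/
def Icrit (e : ℕ) : Set ℝ := Set.Ioo (e : ℝ) (nextE e : ℝ)

/-- The set `X^e`. -/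
def Xe (lam : ℝ) (e : ℕ) : Set (ℝ × ℝ) :=
  {z | z ∈ Xdom lam ∧ ∀ w ∈ returnOrbit lam z, Ham w ∈ Icrit e}

/-- A point of `X^e` is regular if it is not a transition point and its return
orbit avoids `Σ`. -/
def IsRegularPt (lam : ℝ) (e : ℕ) (z : ℝ × ℝ) : Prop :=
  z ∈ Xe lam e ∧ z ∉ TransSet lam ∧ returnOrbit lam z ∩ SigmaSet lam = ∅

/-- `J` is a maximal subinterval `Ĩ^e(λ)` of `I^e` on which all points of `X^e`
are regular. -/
def IsMaxRegInterval (lam : ℝ) (e : ℕ) (J : Set ℝ) : Prop :=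
  J ⊆ Icrit e ∧ J.OrdConnected ∧
    (∀ z ∈ Xe lam e, Ham z ∈ J → IsRegularPt lam e z) ∧
    ∀ J' : Set ℝ, J ⊆ J' → J' ⊆ Icrit e → J'.OrdConnected →
      (∀ z ∈ Xe lam e, Ham z ∈ J' → IsRegularPt lam e z) → J' = J

/-- The regular domain `X̃^e` determined by the interval `J = Ĩ^e(λ)`. -/
def Xtilde (lam : ℝ) (e : ℕ) (J : Set ℝ) : Set (ℝ × ℝ) :=
  {z | z ∈ Xe lam e ∧ Ham z ∈ J}

/-- The type of a vertex: the floor of the absolute value of its non-integer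
coordinate. -/
def vtype (z : ℝ × ℝ) : ℕ :=
  if ∃ m : ℤ, z.1 = (m : ℝ) then (⌊|z.2|⌋).toNat else (⌊|z.1|⌋).toNat

/-- `v` (1-indexed, entries `v 1, …, v k` with `k = ⌊√e⌋+1`) is the vertex list
of the polygon class of `e`, and `o j` records whether the `j`-th vertex lies on
a horizontal lattice line (i.e. has integer `y`-coordinate): for every value
`a ∈ I^e`, the vertices of the level polygon `{𝒫 = a}` lying in the first octant,
enumerated clockwise (i.e. by increasing `x`-coordinate), have types
`v 1, …, v k`. -/
def IsVertexList (e : ℕ) (v : ℕ → ℕ) (o : ℕ → Bool) : Prop :=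
  ∀ a ∈ Icrit e, ∃ p : ℕ → ℝ × ℝ,
    (∀ j, 1 ≤ j → j ≤ Nat.sqrt e + 1 →
      Ham (p j) = a ∧ p j ∈ DeltaSet ∧ 0 ≤ (p j).2 ∧ (p j).2 ≤ (p j).1 ∧
        vtype (p j) = v j ∧ (o j = true ↔ ∃ n : ℤ, (p j).2 = (n : ℝ))) ∧
    (∀ i j, 1 ≤ i → i < j → j ≤ Nat.sqrt e + 1 → (p i).1 < (p j).1) ∧
    (∀ w : ℝ × ℝ, Ham w = a → w ∈ DeltaSet → 0 ≤ w.2 → w.2 ≤ w.1 →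
      ∃ j, 1 ≤ j ∧ j ≤ Nat.sqrt e + 1 ∧ w = p j)

/-- The extended vertex list: `v_j = v_{2k−j}` for `k < j ≤ 2k−1`. -/
def vext (e : ℕ) (v : ℕ → ℕ) (j : ℕ) : ℕ :=
  if j ≤ Nat.sqrt e + 1 then v j else v (2 * (Nat.sqrt e + 1) - j)

/-- The extended orientation list. -/
def oext (e : ℕ) (o : ℕ → Bool) (j : ℕ) : Bool :=
  if j ≤ Nat.sqrt e + 1 then o j else o (2 * (Nat.sqrt e + 1) - j)

/-- The recursively defined integers `q_j` (here `v` is the extended vertex list):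
`q₁ = (2v₁+1)²`, `q_j = q_{j−1}` if `v_j = v_{j−1}`, and
`q_j = lcm((2v_j+1)(2v_{j−1}+1), q_{j−1})` otherwise. -/
def qseq (v : ℕ → ℕ) : ℕ → ℕ
  | 0 => (2 * v 1 + 1) ^ 2
  | 1 => (2 * v 1 + 1) ^ 2
  | j + 2 =>
    if v (j + 2) = v (j + 1) then qseq v (j + 1)
    else Nat.lcm ((2 * v (j + 2) + 1) * (2 * v (j + 1) + 1)) (qseq v (j + 1))

/-- `p_j = q_j/(2v_j+1)`. -/
def pseq (v : ℕ → ℕ) (j : ℕ) : ℕ := qseq v j / (2 * v j + 1)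

/-- `q = q_{2k−1}`. -/
def qval (e : ℕ) (v : ℕ → ℕ) : ℕ := qseq (vext e v) (2 * (Nat.sqrt e + 1) - 1)

/-- The vector `L_j = (λ q_j/(2v₁+1))·(1,1)`. -/
def Lvec (lam : ℝ) (v1 : ℕ) (qj : ℕ) : ℝ × ℝ :=
  (lam * (qj : ℝ) / (2 * (v1 : ℝ) + 1), lam * (qj : ℝ) / (2 * (v1 : ℝ) + 1))

/-- The lattice `𝕃 = ℤ·L_j + ℤ·((L_j − 𝐰_{v₁,v₁})/2)` as an additive subgroup
of `ℝ²`. -/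
def latticeL (lam : ℝ) (v1 : ℕ) (qj : ℕ) : AddSubgroup (ℝ × ℝ) :=
  AddSubgroup.closure
    {Lvec lam v1 qj, (2⁻¹ : ℝ) • (Lvec lam v1 qj - wmn lam (v1 : ℤ) (v1 : ℤ))}

/-- Forward transit time of `F_λ⁴` to `Λ`. -/
def tTrans (lam : ℝ) (z : ℝ × ℝ) : ℕ :=
  sInf {i : ℕ | 1 ≤ i ∧ (Fl lam)^[4 * i] z ∈ TransSet lam}

/-- The strip map `Ψ(z) = F_λ^{4t(z)}(z)`. -/
def Psi (lam : ℝ) (z : ℝ × ℝ) : ℝ × ℝ := (Fl lam)^[4 * tTrans lam z] z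

/-- Backward transit time of `F_λ⁻⁴` to `Λ`. -/
def sTrans (lam : ℝ) (z : ℝ × ℝ) : ℕ :=
  sInf {i : ℕ | 1 ≤ i ∧ (Flinv lam)^[4 * i] z ∈ TransSet lam}

/-- The inverse strip map `Ψ⁻¹`. -/
def PsiInv (lam : ℝ) (z : ℝ × ℝ) : ℝ × ℝ := (Flinv lam)^[4 * sTrans lam z] z

/-- `Ψ^j` for `j ∈ {−1} ∪ ℕ`. -/
def PsiPow (lam : ℝ) (j : ℤ) (z : ℝ × ℝ) : ℝ × ℝ :=
  if j < 0 then PsiInv lam z else (Psi lam)^[j.toNat] z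

/-- The coordinate unit vector in the non-integer direction of a vertex lying
on a horizontal (`horiz = true`) resp. vertical lattice line. -/
def evec (horiz : Bool) : ℝ × ℝ := if horiz then (1, 0) else (0, 1)

/-- `s ∈ {0, …, 2v_j}` is the code entry at a vertex point `w` of type `vj`: if
the vertex lies on a horizontal line `y = n` then, writing
`w = λ(⌈v_j/λ⌉ + x_j, ⌈n/λ⌉ + y_j)` with `|y_j| < 2v_j+1`, `s ≡ y_j (mod 2v_j+1)`;
analogously in the vertical case. -/
def CodeAt (lam : ℝ) (vj : ℕ) (horiz : Bool) (w : ℝ × ℝ) (s : ℤ) : Prop :=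
  0 ≤ s ∧ s < 2 * (vj : ℤ) + 1 ∧
    (if horiz then
        ∃ n Y yj : ℤ, w.2 = lam * (Y : ℝ) ∧ Y = ⌈(n : ℝ) / lam⌉ + yj ∧
          |yj| < 2 * (vj : ℤ) + 1 ∧ s ≡ yj [ZMOD (2 * (vj : ℤ) + 1)]
      else
        ∃ m X xj : ℤ, w.1 = lam * (X : ℝ) ∧ X = ⌈(m : ℝ) / lam⌉ + xj ∧
          |xj| < 2 * (vj : ℤ) + 1 ∧ s ≡ xj [ZMOD (2 * (vj : ℤ) + 1)])

/-- `σ` is the orbit code `(σ₋₁, σ₁, …, σ_{2k−1})` of `z`. -/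
def IsOrbitCode (lam : ℝ) (e : ℕ) (v : ℕ → ℕ) (o : ℕ → Bool) (z : ℝ × ℝ)
    (σ : ℤ → ℤ) : Prop :=
  CodeAt lam (v 1) (!(o 1)) (PsiInv lam z) (σ (-1)) ∧
    ∀ j : ℕ, 1 ≤ j → j ≤ 2 * (Nat.sqrt e + 1) - 1 →
      CodeAt lam (vext e v j) (oext e o j) ((Psi lam)^[j] z) (σ (j : ℤ))

/-- The Euclidean norm on `ℝ²`. -/
def enorm2 (z : ℝ × ℝ) : ℝ := Real.sqrt (z.1 ^ 2 + z.2 ^ 2)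

/-- The rotation number `ν(λ) = arccos(λ/2)/(2π)`. -/
def nuRot (lam : ℝ) : ℝ := Real.arccos (lam / 2) / (2 * Real.pi)

/-- Distance from a real number to the nearest integer. -/
def distInt (x : ℝ) : ℝ := |x - (round x : ℝ)|

/-- The first-order recurrence time `t*(λ)`. -/
def tstar (lam : ℝ) : ℕ :=
  sInf {k : ℕ | 1 ≤ k ∧ distInt ((k : ℝ) * nuRot lam) < distInt (4 * nuRot lam)}

/-- The square `A(r,λ)` of lattice points. -/
def Aset (r lam : ℝ) : Set (ℝ × ℝ) := {z | IsLatticePt lam z ∧ max |z.1| |z.2| < r}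

end
/-- Localisation of the recurrence time for rotation number `(1 - e)/4`. -/
lemma rec_aux (e nu : ℝ) (he : 0 < e) (he4 : e ≤ 1 / 8) (hnu : nu = (1 - e) / 4) :
    {k : ℕ | 1 ≤ k ∧ distInt ((k : ℝ) * nu) < distInt (4 * nu)}.Nonempty ∧
    |((sInf {k : ℕ | 1 ≤ k ∧ distInt ((k : ℝ) * nu) < distInt (4 * nu)} : ℕ) : ℝ) - 1 / e| ≤ 4 := by
  have h4 : distInt (4 * nu) = e := by
    apply le_antisymm
    · have h := round_le (4 * nu) 1
      refine le_trans h ?_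
      rw [hnu, abs_le]
      constructor <;> push_cast <;> linarith
    · unfold distInt
      rcases le_or_gt (round (4 * nu)) 0 with h | h
      · have h' : ((round (4 * nu) : ℤ) : ℝ) ≤ 0 := by exact_mod_cast h
        refine le_trans ?_ (le_abs_self _)
        rw [hnu] at h' ⊢
        linarith
      · have h' : (1 : ℝ) ≤ ((round (4 * nu) : ℤ) : ℝ) := by exact_mod_cast h
        refine le_trans ?_ (neg_le_abs _)
        rw [hnu] at h' ⊢
        linarith
  rw [h4]
  have hie : 8 ≤ 1 / e := by rw [le_div_iff₀ he]; linarith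
  have hee : 1 / e * e = 1 := by field_simp
  -- lower bound
  have hlow : ∀ k : ℕ, 1 ≤ k → distInt ((k : ℝ) * nu) < e → 1 / e - 4 ≤ (k : ℝ) := by
    intro k hk hd
    unfold distInt at hd
    generalize round ((k : ℝ) * nu) = n at hd
    rw [abs_lt, hnu] at hd
    obtain ⟨h1, h2⟩ := hd
    have hk' : (1 : ℝ) ≤ k := by exact_mod_cast hk
    have hke : 0 < (k : ℝ) * e := by positivity
    rcases lt_trichotomy ((k : ℤ) - 4 * n) 0 with h | h | h
    · have h' : (k : ℝ) - 4 * n ≤ -1 := by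
        have : (k : ℤ) - 4 * n ≤ -1 := by omega
        exact_mod_cast this
      linarith
    · have h' : (k : ℝ) - 4 * n = 0 := by exact_mod_cast h
      have hk4 : (4 : ℝ) ≤ k := by
        have : 4 ≤ k := by omega
        exact_mod_cast this
      nlinarith
    · have h' : (1 : ℝ) ≤ (k : ℝ) - 4 * n := by exact_mod_cast h
      have : (1 / e) * e ≤ ((k : ℝ) + 4) * e := by rw [hee]; linarith
      linarith [le_of_mul_le_mul_right this he]
  -- witness
  obtain ⟨K, hK1, hKd, hKu⟩ : ∃ k : ℕ, 1 ≤ k ∧ distInt ((k : ℝ) * nu) < e ∧ (k : ℝ) ≤ 1 / e + 4 := by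
    have hr := abs_sub_round ((1 / e - 1) / 4)
    set n := round ((1 / e - 1) / 4) with hn
    rw [abs_le] at hr
    have hn0 : 0 ≤ n := by
      have : (-1 : ℝ) < n := by linarith
      have : (-1 : ℤ) < n := by exact_mod_cast this
      omega
    obtain ⟨m, hm⟩ := Int.eq_ofNat_of_zero_le hn0
    have hmr : (n : ℝ) = (m : ℝ) := by rw [hm]; simp
    rw [hmr] at hr
    refine ⟨4 * m + 1, by omega, ?_, by push_cast; linarith⟩
    refine lt_of_le_of_lt (round_le _ (m : ℤ)) ?_
    have e1 := mul_le_mul_of_nonneg_right hr.1 he.le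
    have e2 := mul_le_mul_of_nonneg_right hr.2 he.le
    rw [hnu, abs_lt]
    push_cast
    constructor <;> nlinarith
  have hne : {k : ℕ | 1 ≤ k ∧ distInt ((k : ℝ) * nu) < e}.Nonempty := ⟨K, hK1, hKd⟩
  refine ⟨hne, ?_⟩
  obtain ⟨hm1, hm2⟩ := Nat.sInf_mem hne
  have hle : sInf {k : ℕ | 1 ≤ k ∧ distInt ((k : ℝ) * nu) < e} ≤ K := Nat.sInf_le ⟨hK1, hKd⟩
  have hle' : ((sInf {k : ℕ | 1 ≤ k ∧ distInt ((k : ℝ) * nu) < e} : ℕ) : ℝ) ≤ K := by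
    exact_mod_cast hle
  have := hlow _ hm1 hm2
  rw [abs_le]
  constructor <;> linarith

/-- The first-order recurrence time satisfies `t*(λ) = π/λ + O(1)` as `λ → 0⁺`. -/
theorem tstar_asymptotics :
    ∃ C > (0 : ℝ), ∃ lam0 > (0 : ℝ), ∀ lam : ℝ, 0 < lam → lam < lam0 →
      {k : ℕ | 1 ≤ k ∧ distInt ((k : ℝ) * nuRot lam) < distInt (4 * nuRot lam)}.Nonempty ∧
      |(tstar lam : ℝ) - Real.pi / lam| ≤ C := by
  refine ⟨5, by norm_num, 1 / 16, by norm_num, fun lam h0 h1 => ?_⟩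
  have hpi3 := Real.pi_gt_three
  have hpi4 := Real.pi_le_four
  set t := Real.arcsin (lam / 2) with ht
  have hsin : Real.sin t = lam / 2 := Real.sin_arcsin (by linarith) (by linarith)
  have ht0 : 0 < t := Real.arcsin_pos.2 (by linarith)
  have htpi : t ≤ Real.pi / 2 := Real.arcsin_le_pi_div_two _
  have htl : t ≤ lam := by
    have h := Real.mul_le_sin ht0.le htpi
    rw [hsin, div_mul_eq_mul_div, div_le_iff₀ (by linarith)] at h
    nlinarith
  have hlt : lam < 2 * t := by
    have := Real.sin_lt ht0
    linarith
  have hcube : 2 * t - lam ≤ t ^ 3 / 2 := by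
    have := Real.sin_gt_sub_cube ht0
    have h3 : 0 < t ^ 3 := by positivity
    linarith
  have hpos : 0 < 2 * t / Real.pi := by positivity
  obtain ⟨hne, hb⟩ := rec_aux (2 * t / Real.pi) (nuRot lam) hpos
    (by rw [div_le_iff₀ (by linarith)]; linarith)
    (by
      unfold nuRot
      rw [Real.arccos_eq_pi_div_two_sub_arcsin, ← ht]
      field_simp
      ring)
  refine ⟨hne, ?_⟩
  have hd : |1 / (2 * t / Real.pi) - Real.pi / lam| ≤ 1 := by
    have heq : 1 / (2 * t / Real.pi) - Real.pi / lam
        = -(Real.pi * (2 * t - lam) / (2 * t * lam)) := by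
      field_simp
      ring
    have hx : 0 ≤ 2 * t - lam := by linarith
    rw [heq, abs_neg, abs_of_nonneg (by positivity), div_le_one (by positivity)]
    have a1 : Real.pi * (2 * t - lam) ≤ 4 * (t ^ 3 / 2) :=
      mul_le_mul hpi4 hcube hx (by norm_num)
    have a2 : t * t ≤ lam := by nlinarith
    nlinarith
  unfold tstar
  have := abs_sub_le ((sInf {k : ℕ | 1 ≤ k ∧ distInt ((k : ℝ) * nuRot lam) < distInt (4 * nuRot lam)} : ℕ) : ℝ) (1 / (2 * t / Real.pi)) (Real.pi / lam)
  linarith
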